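/- arXiv:1610.05556 — 3 statements merged into one kernel-verified Lean document; each statement's English description precedes it below -/
import Mathlib

section
/- Let V be a finite set and let E0, E1 ⊆ V × V be two edge relations such that the directed graph (V, E0) is acyclic. Define the unrolled graph Ĝ on vertex set ℤ × V with a directed edge from (t,x) to (t,y) whenever (x,y) ∈ E0 and a directed edge from (t,x) to (t+1,y) whenever (x,y) ∈ E1, for every t ∈ ℤ. Then Ĝ is acyclic, i.e., no vertex of ℤ × V reaches itself by a nonempty directed path (the transitive closure of the edge relation of Ĝ is irreflexive). -/
/-- Along a nonempty path of the unrolled graph, either time strictly increases, or the path stays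
within one time slice and projects to a path of `E0`. -/
theorem unrolled_dbn_lt_or_transGen {V : Type*} {E0 E1 : V → V → Prop} {p q : ℤ × V}
    (h : Relation.TransGen
      (fun a b : ℤ × V =>
        (b.1 = a.1 ∧ E0 a.2 b.2) ∨ (b.1 = a.1 + 1 ∧ E1 a.2 b.2)) p q) :
    p.1 < q.1 ∨ (q.1 = p.1 ∧ Relation.TransGen E0 p.2 q.2) := by
  induction h with
  | single h =>
    rcases h with ⟨ht, he⟩ | ⟨ht, -⟩
    · exact Or.inr ⟨ht, .single he⟩
    · left; omega
  | tail _ h ih =>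
    rcases h with ⟨ht, he⟩ | ⟨ht, -⟩
    · rcases ih with hlt | ⟨heq, hp⟩
      · left; omega
      · exact Or.inr ⟨ht.trans heq, hp.tail he⟩
    · left; omega

/-- Let `V` be a finite set and `E0, E1 ⊆ V × V` edge relations with
`(V, E0)` acyclic.  The unrolled graph `Ĝ` on `ℤ × V` has an edge from `(t,x)` to
`(t,y)` whenever `E0 x y` and from `(t,x)` to `(t+1,y)` whenever `E1 x y`.
Then `Ĝ` is acyclic: no vertex reaches itself by a nonempty directed path. -/
theorem unrolled_dbn_acyclic {V : Type*} [Fintype V]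
    (E0 E1 : V → V → Prop)
    (hE0 : ∀ v : V, ¬ Relation.TransGen E0 v v) :
    ∀ p : ℤ × V,
      ¬ Relation.TransGen
        (fun a b : ℤ × V =>
          (b.1 = a.1 ∧ E0 a.2 b.2) ∨ (b.1 = a.1 + 1 ∧ E1 a.2 b.2)) p p := by
  intro p h
  rcases unrolled_dbn_lt_or_transGen h with hlt | ⟨-, hp⟩
  · exact lt_irrefl _ hlt
  · exact hE0 p.2 hp
end

section
/- Let D be the unrolled mixed graph of a dynamic causal network with static confounders: every directed edge goes from a vertex (t,x) to a vertex (t,y) or (t+1,y), and every bidirected edge joins two vertices of the same slice. Let X ⊆ V_{t_x} and Y ⊆ V_{t_y} be sets of vertices with t_x < t_y. If two C-forests F' ⊆ F form a hedge for P(Y|do(X)) in D, then F ⊆ V_{t_x} (and hence also F' ⊆ V_{t_x} and the root R ⊆ V_{t_x}). -/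
/-! STATEMENT 4: In the unrolled mixed graph of a DCN with static confounders
(directed edges go from `(t,x)` to `(t,y)` or `(t+1,y)`, bidirected edges join two
vertices of the same timeSlice), if `X ⊆ V_{t_x}`, `Y ⊆ V_{t_y}` with `t_x < t_y`, and two
C-forests `F' ⊆ F` form a hedge for `P(Y|do(X))`, then `F ⊆ V_{t_x}` (hence also
`F' ⊆ V_{t_x}` and the root `R ⊆ V_{t_x}`). -/

/-- The time timeSlice `V_t = {t} × V`. -/
def timeSlice {V : Type*} (t : ℤ) : Set (ℤ × V) := {p | p.1 = t}

/-- `S` is bidirected-connected: any two of its elements are joined by a path of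
bidirected edges all of whose vertices lie in `S`. -/
def BConnected {V : Type*} (B : ℤ × V → ℤ × V → Prop) (S : Set (ℤ × V)) : Prop :=
  ∀ a ∈ S, ∀ b ∈ S,
    Relation.ReflTransGen (fun u v : ℤ × V => B u v ∧ u ∈ S ∧ v ∈ S) a b

/-- A C-forest: a bidirected-connected set of vertices in which every vertex has at most
one child (w.r.t. the directed edges) inside the set. -/
def CForest {V : Type*} (D B : ℤ × V → ℤ × V → Prop) (F : Set (ℤ × V)) : Prop :=
  BConnected B F ∧
    ∀ v ∈ F, ∀ c₁ ∈ F, ∀ c₂ ∈ F, D v c₁ → D v c₂ → c₁ = c₂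

/-- The root of a C-forest: its vertices with no child inside the set. -/
def root {V : Type*} (D : ℤ × V → ℤ × V → Prop) (F : Set (ℤ × V)) : Set (ℤ × V) :=
  {v | v ∈ F ∧ ∀ c ∈ F, ¬ D v c}

/-- `u` is an ancestor of `w`: there is a (possibly empty) directed path from `u` to `w`. -/
def ancestor {V : Type*} (D : ℤ × V → ℤ × V → Prop) (u w : ℤ × V) : Prop :=
  Relation.ReflTransGen D u w

/-- The graph `D_X̄`: delete all directed edges whose head lies in `X`. -/
def delEdgesInto {V : Type*} (D : ℤ × V → ℤ × V → Prop) (X : Set (ℤ × V)) :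
    ℤ × V → ℤ × V → Prop :=
  fun a b => D a b ∧ b ∉ X

/-- `F' ⊆ F` form a hedge for `P(Y|do(X))`: both are C-forests with the same root `R`,
`F ∩ X ≠ ∅`, `F' ∩ X = ∅`, and every vertex of `R` is an ancestor of some vertex of `Y`
in `D_X̄`. -/
def Hedge {V : Type*} (D B : ℤ × V → ℤ × V → Prop) (X Y F' F : Set (ℤ × V)) : Prop :=
  CForest D B F ∧ CForest D B F' ∧ F' ⊆ F ∧
  root D F' = root D F ∧
  (F ∩ X).Nonempty ∧ F' ∩ X = ∅ ∧
  ∀ r ∈ root D F, ∃ y ∈ Y, ancestor (delEdgesInto D X) r y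

theorem ReflTransGen.fst_eq_of_static {V : Type*} {B : ℤ × V → ℤ × V → Prop}
    (hB : ∀ a b : ℤ × V, B a b → a.1 = b.1) {S : Set (ℤ × V)} {a b : ℤ × V}
    (h : Relation.ReflTransGen (fun u v : ℤ × V => B u v ∧ u ∈ S ∧ v ∈ S) a b) :
    a.1 = b.1 := by
  induction h with
  | refl => rfl
  | tail _ h ih => exact ih.trans (hB _ _ h.1)

/-- With static confounders, a bidirected-connected set meeting a time slice lies in it. -/
theorem BConnected.subset_timeSlice {V : Type*} {B : ℤ × V → ℤ × V → Prop}
    (hB : ∀ a b : ℤ × V, B a b → a.1 = b.1) {S : Set (ℤ × V)} (hS : BConnected B S)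
    {t : ℤ} {a : ℤ × V} (ha : a ∈ S) (hat : a ∈ timeSlice t) : S ⊆ timeSlice t :=
  fun b hb => (ReflTransGen.fst_eq_of_static hB (hS a ha b hb)).symm.trans hat

theorem hedge_static_confounders_in_intervention_slice
    {V : Type*} [Fintype V] [Nonempty V]
    (D B : ℤ × V → ℤ × V → Prop)
    (hD : ∀ a b : ℤ × V, D a b → b.1 = a.1 ∨ b.1 = a.1 + 1)
    (hBsym : ∀ a b : ℤ × V, B a b → B b a)
    (hBirr : ∀ a : ℤ × V, ¬ B a a)
    (hBstatic : ∀ a b : ℤ × V, B a b → a.1 = b.1)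
    (tx ty : ℤ) (hlt : tx < ty)
    (X Y : Set (ℤ × V)) (hX : X ⊆ timeSlice tx) (hY : Y ⊆ timeSlice ty)
    (F' F : Set (ℤ × V)) (hH : Hedge D B X Y F' F) :
    F ⊆ timeSlice tx ∧ F' ⊆ timeSlice tx ∧ root D F ⊆ timeSlice tx := by
  obtain ⟨hF, -, hsub, -, ⟨x, hxF, hxX⟩, -, -⟩ := hH
  have hFt := hF.1.subset_timeSlice hBstatic hxF (hX hxX)
  exact ⟨hFt, hsub.trans hFt, fun v hv => hFt hv.1⟩
end

section
/- Let D be the unrolled mixed graph of a dynamic causal network with static confounders: every directed edge goes from a vertex (t,x) to a vertex (t,y) of the same slice or to a vertex (t+1,y) of the next slice, and every bidirected edge joins two vertices of the same slice. Then for every time t, the slice V_t d-separates the set of all vertices in slices strictly before t from the set of all vertices in slices strictly after t: every path in the mixed graph between a vertex of ∪_{s<t} V_s and a vertex of ∪_{s>t} V_s is blocked by V_t. -/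
/-! STATEMENT 6: In the unrolled mixed graph of a DCN with static confounders
(directed edges go from `(t,x)` to `(t,y)` or `(t+1,y)`, bidirected edges join two
vertices of the same slice), for every time `t` the slice `V_t` d-separates the set of
all vertices of slices strictly before `t` from the set of all vertices of slices
strictly after `t`: every path between such vertices is blocked by `V_t`. -/

/-- The kind of an edge traversed on a path: a directed edge traversed forwards, a
directed edge traversed backwards, or a bidirected (confounder) edge. -/
inductive EKind : Type
  | fwd : EKind
  | bwd : EKind
  | bid : EKind

/-- The edge (of kind `ek`) between consecutive path vertices points into the
right-hand vertex. A bidirected edge points into both of its endpoints. -/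
def intoRight (ek : EKind) : Prop := ek = EKind.fwd ∨ ek = EKind.bid

/-- The edge (of kind `ek`) between consecutive path vertices points into the
left-hand vertex. A bidirected edge points into both of its endpoints. -/
def intoLeft (ek : EKind) : Prop := ek = EKind.bwd ∨ ek = EKind.bid

/-- A path between `a` and `b` in the mixed graph with directed edges `D` and bidirected
edges `B`: a sequence of `k ≥ 1` steps through distinct vertices `v 0 = a, …, v k = b`,
each consecutive pair joined by a directed edge (traversed in either orientation) or by
a bidirected edge. -/
structure MPath {α : Type*} (D B : α → α → Prop) (a b : α) where
  k : ℕ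
  hk : 0 < k
  v : ℕ → α
  e : ℕ → EKind
  hstart : v 0 = a
  hend : v k = b
  hinj : ∀ i ≤ k, ∀ j ≤ k, v i = v j → i = j
  hstep : ∀ i < k,
    (match e i with
      | EKind.fwd => D (v i) (v (i + 1))
      | EKind.bwd => D (v (i + 1)) (v i)
      | EKind.bid => B (v i) (v (i + 1)))

/-- The interior vertex at position `i` of the path is a collider: both adjoining edges
point into it. -/
def MPath.collider {α : Type*} {D B : α → α → Prop} {a b : α}
    (p : MPath D B a b) (i : ℕ) : Prop :=
  0 < i ∧ i < p.k ∧ intoRight (p.e (i - 1)) ∧ intoLeft (p.e i)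

/-- The path is blocked by the set `C`: some interior non-collider of the path lies in
`C`, or some collider of the path has no descendant (including itself) in `C`. -/
def MPath.blocked {α : Type*} {D B : α → α → Prop} {a b : α}
    (p : MPath D B a b) (C : Set α) : Prop :=
  (∃ i, 0 < i ∧ i < p.k ∧ ¬ p.collider i ∧ p.v i ∈ C) ∨
  (∃ i, p.collider i ∧ ∀ u, Relation.ReflTransGen D (p.v i) u → u ∉ C)

theorem slice_d_separates_past_from_future
    {V : Type*} [Fintype V] [Nonempty V]
    (D B : ℤ × V → ℤ × V → Prop)
    (hD : ∀ a b : ℤ × V, D a b → b.1 = a.1 ∨ b.1 = a.1 + 1)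
    (hBsym : ∀ a b : ℤ × V, B a b → B b a)
    (hBirr : ∀ a : ℤ × V, ¬ B a a)
    (hBstatic : ∀ a b : ℤ × V, B a b → a.1 = b.1)
    (t : ℤ) (a b : ℤ × V) (ha : a.1 < t) (hb : t < b.1)
    (p : MPath D B a b) :
    p.blocked {q : ℤ × V | q.1 = t} := by
  -- The first index whose vertex lies strictly after `t` is entered from slice `t` by a forward edge.
  have hex : ∃ j, j ≤ p.k ∧ t < (p.v j).1 := ⟨p.k, le_rfl, by rw [p.hend]; exact hb⟩
  obtain ⟨j, ⟨hjk, hjt⟩, hmin⟩ :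
      ∃ j, (j ≤ p.k ∧ t < (p.v j).1) ∧ ∀ i < j, ¬ (i ≤ p.k ∧ t < (p.v i).1) :=
    ⟨Nat.find hex, Nat.find_spec hex, fun _ hi => Nat.find_min hex hi⟩
  obtain _ | i := j
  · rw [p.hstart] at hjt
    omega
  have hle : (p.v i).1 ≤ t := not_lt.mp fun h => hmin i i.lt_succ_self ⟨by omega, h⟩
  have hstep := p.hstep i hjk
  cases he : p.e i with
  | fwd =>
    simp only [he] at hstep
    have hslice : (p.v i).1 = t := by
      have := hD _ _ hstep
      omega
    refine Or.inl ⟨i, Nat.pos_of_ne_zero ?_, hjk, ?_, hslice⟩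
    · rintro rfl
      rw [p.hstart] at hslice
      omega
    · rintro ⟨-, -, -, h⟩
      simp [intoLeft, he] at h
  | bwd =>
    simp only [he] at hstep
    have := hD _ _ hstep
    omega
  | bid =>
    simp only [he] at hstep
    have := hBstatic _ _ hstep
    omega
end
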